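/- arXiv:2409.07009 — 2 statements merged into one kernel-verified Lean document; each statement's English description precedes it below -/
import Mathlib

section
/- Let f, g : ℝ → ℝ be continuous functions with f(x+1) + f(x) ∈ ℤ and g(x+1) + g(x) ∈ ℤ for all x ∈ ℝ. Then f and g are fiberwise homotopic (through functions satisfying the same twisted periodicity condition) if and only if the integers f(1) + f(0) and g(1) + g(0) are congruent modulo 2. -/
/-- A continuous real function with integer values on a preconnected space is constant. -/
theorem Continuous.eq_of_forall_exists_intCast {X : Type*} [TopologicalSpace X]
    [PreconnectedSpace X] {F : X → ℝ} (hF : Continuous F) (h : ∀ x, ∃ k : ℤ, F x = k) (x y : X) :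
    F x = F y := by
  choose k hk using h
  have hk' : Continuous k := by
    rw [Int.isClosedEmbedding_coe_real.isEmbedding.continuous_iff]
    exact hF.congr hk
  rw [hk, hk, PreconnectedSpace.constant ‹_› hk' (x := x) (y := y)]


/-- Two continuous functions `f g : ℝ → ℝ` with `f (x+1) + f x ∈ ℤ`
(sections of the Klein bottle as a circle bundle over the circle) are fiberwise
homotopic iff the integers `f 1 + f 0` and `g 1 + g 0` are congruent mod `2`. -/
theorem klein_fiberwise_homotopic_iff_mod_two
    (f g : ℝ → ℝ) (hf : Continuous f) (hg : Continuous g)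
    (hfp : ∀ x : ℝ, ∃ n : ℤ, f (x + 1) + f x = n)
    (hgp : ∀ x : ℝ, ∃ n : ℤ, g (x + 1) + g x = n)
    (m n : ℤ) (hm : f 1 + f 0 = m) (hn : g 1 + g 0 = n) :
    (∃ H : ℝ × unitInterval → ℝ, Continuous H ∧
      (∀ (x : ℝ) (t : unitInterval), ∃ k : ℤ, H (x + 1, t) + H (x, t) = k) ∧
      (∀ x : ℝ, ∃ k : ℤ, H (x, 0) - f x = k) ∧
      (∀ x : ℝ, ∃ k : ℤ, H (x, 1) - g x = k)) ↔
    m ≡ n [ZMOD 2] := by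
  constructor
  · rintro ⟨H, hH, hS, h0, h1⟩
    obtain ⟨a, ha⟩ := h0 0
    obtain ⟨b, hb⟩ := h1 0
    have ha' := (show Continuous fun x : ℝ => H (x, 0) - f x by
      fun_prop).eq_of_forall_exists_intCast h0 1 0
    have hb' := (show Continuous fun x : ℝ => H (x, 1) - g x by
      fun_prop).eq_of_forall_exists_intCast h1 1 0
    have hc := (show Continuous fun t : unitInterval => H (0 + 1, t) + H (0, t) by
      fun_prop).eq_of_forall_exists_intCast (hS 0) 0 1
    simp only [zero_add] at ha' hb' hc
    have key : (m : ℝ) + 2 * a = n + 2 * b := by linarith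
    have key' : m + 2 * a = n + 2 * b := by exact_mod_cast key
    exact Int.modEq_iff_dvd.mpr ⟨a - b, by linarith⟩
  · intro hmn
    obtain ⟨j, hj⟩ := hmn.symm.dvd
    have hj' : (m : ℝ) - n = 2 * j := by exact_mod_cast hj
    have hfm (x : ℝ) : f (x + 1) + f x = m := by
      have := (show Continuous fun x : ℝ => f (x + 1) + f x by
        fun_prop).eq_of_forall_exists_intCast hfp x 0
      simp only [zero_add] at this
      linarith
    have hgn (x : ℝ) : g (x + 1) + g x = n := by
      have := (show Continuous fun x : ℝ => g (x + 1) + g x by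
        fun_prop).eq_of_forall_exists_intCast hgp x 0
      simp only [zero_add] at this
      linarith
    refine ⟨fun p => (1 - (p.2 : ℝ)) * f p.1 + p.2 * (g p.1 + j), by fun_prop,
      fun x t => ⟨m, ?_⟩, fun x => ⟨0, by simp⟩, fun x => ⟨j, by simp⟩⟩
    linear_combination (1 - (t : ℝ)) * hfm x + t * hgn x - t * hj'
end

section
/- The fiberwise homotopy relation on the set of continuous functions f : ℝ → ℝ satisfying f(x+1) + f(x) ∈ ℤ for all x ∈ ℝ has exactly two equivalence classes. -/
/-- A section of the Klein bottle viewed as a circle bundle over the circle: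
a continuous `f : ℝ → ℝ` with `f (x+1) + f x ∈ ℤ` for all `x`. -/
def KleinSect : Type :=
  {f : ℝ → ℝ // Continuous f ∧ ∀ x : ℝ, ∃ n : ℤ, f (x + 1) + f x = n}

/-- Fiberwise homotopy of sections of the Klein bottle over the circle. -/
def KleinSect.FibHomotopic (f g : KleinSect) : Prop :=
  ∃ H : ℝ × unitInterval → ℝ, Continuous H ∧
    (∀ (x : ℝ) (t : unitInterval), ∃ n : ℤ, H (x + 1, t) + H (x, t) = n) ∧
    (∀ x : ℝ, ∃ n : ℤ, H (x, 0) - f.1 x = n) ∧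
    (∀ x : ℝ, ∃ n : ℤ, H (x, 1) - g.1 x = n)

/-- A continuous integer-valued real function on a connected space is constant. -/
theorem exists_int_forall_eq_of_continuous {X : Type*} [TopologicalSpace X] [ConnectedSpace X]
    {F : X → ℝ} (hF : Continuous F) (h : ∀ x, ∃ n : ℤ, F x = n) : ∃ n : ℤ, ∀ x, F x = n := by
  choose k hk using h
  have hk' : Continuous k := by
    rw [Int.isClosedEmbedding_coe_real.continuous_iff]
    exact hF.congr hk
  obtain ⟨x₀⟩ := (inferInstance : Nonempty X)
  exact ⟨k x₀, fun x => by rw [hk, PreconnectedSpace.constant inferInstance hk' (x := x) (y := x₀)]⟩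

namespace KleinSect

theorem exists_twist (f : KleinSect) : ∃ n : ℤ, ∀ x : ℝ, f.1 (x + 1) + f.1 x = n := by
  have hf := f.2.1
  exact exists_int_forall_eq_of_continuous (by fun_prop) f.2.2

/-- The constant integer value of `f (x + 1) + f x`. -/
noncomputable def twist (f : KleinSect) : ℤ := f.exists_twist.choose

theorem add_eq_twist (f : KleinSect) (x : ℝ) : f.1 (x + 1) + f.1 x = f.twist :=
  f.exists_twist.choose_spec x

/-- The constant section with value `n / 2`. -/
noncomputable def halfInt (n : ℤ) : KleinSect :=
  ⟨fun _ => n / 2, continuous_const, fun _ => ⟨n, add_halves _⟩⟩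

theorem twist_halfInt (n : ℤ) : (halfInt n).twist = n := by
  have h : (n / 2 + n / 2 : ℝ) = (halfInt n).twist := (halfInt n).add_eq_twist 0
  rw [add_halves] at h
  exact_mod_cast h.symm

/-- The twist modulo two is invariant under fiberwise homotopy. -/
theorem FibHomotopic.twist_eq {f g : KleinSect} (h : FibHomotopic f g) :
    (f.twist : ZMod 2) = g.twist := by
  obtain ⟨H, hH, hadd, h0, h1⟩ := h
  obtain ⟨N, hN⟩ := exists_int_forall_eq_of_continuous
    (F := fun p : ℝ × unitInterval => H (p.1 + 1, p.2) + H p) (by fun_prop)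
    (fun p => hadd p.1 p.2)
  have end_twist (s : unitInterval) (u : KleinSect) (hu : ∀ x : ℝ, ∃ n : ℤ, H (x, s) - u.1 x = n) :
      (N : ZMod 2) = u.twist := by
    have huc := u.2.1
    obtain ⟨a, ha⟩ := exists_int_forall_eq_of_continuous
      (F := fun x : ℝ => H (x, s) - u.1 x) (by fun_prop) hu
    have key : N = u.twist + 2 * a := by
      have e1 := hN (0, s)
      have e2 := ha 0
      have e3 := ha (0 + 1)
      have e4 := u.add_eq_twist 0
      simp only at e1 e2 e3
      have : (N : ℝ) = u.twist + 2 * a := by linarith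
      exact_mod_cast this
    rw [key]
    push_cast
    rw [show (2 : ZMod 2) = 0 from rfl, zero_mul, add_zero]
  exact (end_twist 0 f h0).symm.trans (end_twist 1 g h1)

/-- A section is homotopic to any constant half-integer section whose twist has the same parity. -/
theorem fibHomotopic_halfInt (f : KleinSect) {m k : ℤ} (h : f.twist = m + 2 * k) :
    FibHomotopic f (halfInt m) := by
  have hf := f.2.1
  refine ⟨fun p => (1 - (p.2 : ℝ)) * f.1 p.1 + p.2 * (f.twist / 2), by fun_prop,
    fun x t => ⟨f.twist, ?_⟩, fun x => ⟨0, by simp⟩, fun x => ⟨k, ?_⟩⟩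
  · linear_combination (1 - (t : ℝ)) * f.add_eq_twist x
  · have hR : (f.twist : ℝ) = m + 2 * k := by exact_mod_cast h
    change (1 - (1 : ℝ)) * f.1 x + 1 * (f.twist / 2) - m / 2 = k
    linear_combination hR / 2

end KleinSect

/-- The fiberwise homotopy relation on sections of the Klein bottle
over the circle has exactly two equivalence classes. -/
theorem klein_two_classes :
    ∃ a b : Quot KleinSect.FibHomotopic, a ≠ b ∧
      ∀ c : Quot KleinSect.FibHomotopic, c = a ∨ c = b := by
  refine ⟨Quot.mk _ (.halfInt 0), Quot.mk _ (.halfInt 1), fun h => ?_, ?_⟩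
  · have := congrArg (Quot.lift (fun f : KleinSect => (f.twist : ZMod 2))
      fun _ _ => KleinSect.FibHomotopic.twist_eq) h
    simp [KleinSect.twist_halfInt] at this
  · rintro ⟨f⟩
    obtain ⟨k, hk | hk⟩ := Int.even_or_odd' f.twist
    · exact .inl (Quot.sound (f.fibHomotopic_halfInt (k := k) (by lia)))
    · exact .inr (Quot.sound (f.fibHomotopic_halfInt (k := k) (by lia)))
end
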